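/- Finite-Control Theorem: if H[Future] is finite, then for every prescient rival R̂, H[Future] − H[Future | R̂] ≤ C_μ. -/

import Mathlib

open MeasureTheory Real

/-- Probability of an event, as a real number. -/
noncomputable def pr {Ω : Type*} [MeasurableSpace Ω] (μ : Measure Ω) (E : Set Ω) : ℝ :=
  (μ E).toReal

/-- Shannon entropy (in nats) of a discrete random variable. -/
noncomputable def ent {Ω α : Type*} [MeasurableSpace Ω] (μ : Measure Ω) (X : Ω → α) : ℝ :=
  ∑' a : α, Real.negMulLog (pr μ (X ⁻¹' {a}))

/-- Conditional Shannon entropy `H[X|Y]`, defined directly by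
`∑ p(x,y) log (p(y)/p(x,y))`. -/
noncomputable def cent {Ω α β : Type*} [MeasurableSpace Ω] (μ : Measure Ω)
    (X : Ω → α) (Y : Ω → β) : ℝ :=
  ∑' q : α × β,
    pr μ (X ⁻¹' {q.1} ∩ Y ⁻¹' {q.2}) *
      Real.log (pr μ (Y ⁻¹' {q.2}) / pr μ (X ⁻¹' {q.1} ∩ Y ⁻¹' {q.2}))

/-- Mutual information `I[X;Y] = ∑ p(x,y) log (p(x,y)/(p(x)p(y)))`. -/
noncomputable def mutInf {Ω α β : Type*} [MeasurableSpace Ω] (μ : Measure Ω)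
    (X : Ω → α) (Y : Ω → β) : ℝ :=
  ∑' q : α × β,
    pr μ (X ⁻¹' {q.1} ∩ Y ⁻¹' {q.2}) *
      Real.log (pr μ (X ⁻¹' {q.1} ∩ Y ⁻¹' {q.2}) /
        (pr μ (X ⁻¹' {q.1}) * pr μ (Y ⁻¹' {q.2})))

/-- The left shift on bi-infinite sequences. -/
def shift {A : Type*} (ω : ℤ → A) : ℤ → A := fun n => ω (n + 1)

/-- The semi-infinite past `(..., S₋₂, S₋₁)` of a bi-infinite realization. -/
def Past {A : Type*} (ω : ℤ → A) : ℕ → A := fun n => ω (-(n + 1 : ℤ))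

/-- The next `L` symbols `(S₀, ..., S_{L-1})`. -/
def nextL {A : Type*} (L : ℕ) (ω : ℤ → A) : Fin L → A := fun i => ω ((i : ℕ) : ℤ)

/-- The next symbol `S₀`. -/
def nextSym {A : Type*} (ω : ℤ → A) : A := ω 0
/-- The semi-infinite future `(S₀, S₁, ...)` of a bi-infinite realization. -/
def Fut {A : Type*} (ω : ℤ → A) : ℕ → A := fun n => ω (n : ℤ)

/-- Conditional probability of a future `f` given a past `p`. -/
noncomputable def condFut {A : Type*} [MeasurableSpace A] (μ : Measure (ℤ → A))
    (f p : ℕ → A) : ENNReal :=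
  μ {ω | Fut ω = f ∧ Past ω = p} / μ {ω | Past ω = p}

/-- Causal equivalence of two pasts: identical conditional distributions of the future. -/
def causalEquiv {A : Type*} [MeasurableSpace A] (μ : Measure (ℤ → A))
    (p p' : ℕ → A) : Prop :=
  ∀ f : ℕ → A, condFut μ f p = condFut μ f p'

/-- The causal state of a past: its causal-equivalence class. -/
def eps {A : Type*} [MeasurableSpace A] (μ : Measure (ℤ → A)) (p : ℕ → A) :
    Set (ℕ → A) :=
  {p' | causalEquiv μ p p'}

/-- The causal-state random variable `S = ε(Past)`. -/
noncomputable def epsState {A : Type*} [MeasurableSpace A] (μ : Measure (ℤ → A))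
    (ω : ℤ → A) : Set (ℕ → A) :=
  eps μ (Past ω)

/-- Append a new most-recent symbol `s` to a past `p`. -/
def extendPast {A : Type*} (p : ℕ → A) (s : A) : ℕ → A :=
  fun n => Nat.casesOn n s p

section Helpers

/-- Two symbols that no measurable set separates. -/
def RR {A : Type*} [MeasurableSpace A] (a b : A) : Prop :=
  ∀ s : Set A, MeasurableSet s → (a ∈ s ↔ b ∈ s)

lemma RR.rfl' {A : Type*} [MeasurableSpace A] (a : A) : RR a a := fun _ _ => Iff.rfl
lemma RR.symm' {A : Type*} [MeasurableSpace A] {a b : A} (h : RR a b) : RR b a :=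
  fun s hs => (h s hs).symm
lemma RR.trans' {A : Type*} [MeasurableSpace A] {a b c : A} (h : RR a b) (h2 : RR b c) :
    RR a c := fun s hs => (h s hs).trans (h2 s hs)

lemma RR_meas {A : Type*} [MeasurableSpace A] [Countable A] (a : A) :
    MeasurableSet {b | RR a b} := by
  have : {b | RR a b} = measurableAtom a := by
    ext b
    simp only [Set.mem_ofPred_eq, measurableAtom, Set.mem_iInter]
    constructor
    · intro h s has hs
      exact (h s hs).1 has
    · intro h s hs
      constructor
      · intro ha
        exact h s ha hs
      · intro hb
        by_contra ha
        exact h sᶜ ha hs.compl hb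
  rw [this]
  exact MeasurableSet.measurableAtom_of_countable a

/-- Cylinder of realizations indistinguishable from `w` on `I`. -/
def KK {A : Type*} [MeasurableSpace A] (I : Set ℤ) (w : ℤ → A) : Set (ℤ → A) :=
  {ω | ∀ z ∈ I, RR (w z) (ω z)}

lemma KK_meas {A : Type*} [MeasurableSpace A] [Countable A] (I : Set ℤ) (w : ℤ → A) :
    MeasurableSet (KK I w) := by
  have : KK I w = ⋂ z ∈ I, (fun ω : ℤ → A => ω z) ⁻¹' {b | RR (w z) b} := by
    ext ω; simp [KK]
  rw [this]
  exact MeasurableSet.biInter (Set.to_countable I)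
    fun z _ => (measurable_pi_apply z) (RR_meas (w z))

lemma KK_congr {A : Type*} [MeasurableSpace A] {I : Set ℤ} {w w' : ℤ → A}
    (h : ∀ z ∈ I, RR (w z) (w' z)) : KK I w = KK I w' := by
  ext ω
  exact ⟨fun hω z hz => (h z hz).symm'.trans' (hω z hz),
    fun hω z hz => (h z hz).trans' (hω z hz)⟩

lemma sat_meas {A : Type*} [MeasurableSpace A] (E : Set (ℤ → A)) (hE : MeasurableSet E) :
    ∀ ω ω' : ℤ → A, (∀ z, RR (ω z) (ω' z)) → (ω ∈ E ↔ ω' ∈ E) := by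
  have h := MeasurableSpace.measurableSet_iSup.1 hE
  induction h with
  | basic u hu =>
    obtain ⟨i, s, hs, rfl⟩ := hu
    intro ω ω' h
    exact h i s hs
  | empty => intro _ _ _; rfl
  | compl t ht ih =>
    intro ω ω' h
    have := ih (MeasurableSpace.measurableSet_iSup.2 ht) ω ω' h
    simp [this]
  | iUnion f hf ih =>
    intro ω ω' h
    simp only [Set.mem_iUnion]
    exact exists_congr fun n => ih n (MeasurableSpace.measurableSet_iSup.2 (hf n)) ω ω' h

lemma sat_eq {A : Type*} [MeasurableSpace A] (μ : Measure (ℤ → A)) (I : Set ℤ) (w : ℤ → A) :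
    μ {ω | ∀ z ∈ I, ω z = w z} = μ (KK I w) := by
  classical
  apply le_antisymm
  · apply measure_mono
    intro ω h z hz
    rw [h z hz]
    exact RR.rfl' _
  · rw [← measure_toMeasurable {ω : ℤ → A | ∀ z ∈ I, ω z = w z}]
    apply measure_mono
    intro ω h
    have h1 : (fun z => if z ∈ I then w z else ω z) ∈
        toMeasurable μ {ω : ℤ → A | ∀ z ∈ I, ω z = w z} := by
      apply subset_toMeasurable
      intro z hz
      simp [hz]
    refine (sat_meas _ (measurableSet_toMeasurable _ _) _ ω ?_).1 h1
    intro z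
    by_cases hz : z ∈ I
    · simpa [hz] using h z hz
    · simpa [hz] using RR.rfl' _

lemma shift_iter {A : Type*} (m : ℕ) (ω : ℤ → A) (z : ℤ) : shift^[m] ω z = ω (z + m) := by
  induction m generalizing ω with
  | zero => simp
  | succ k ih =>
    rw [Function.iterate_succ_apply, ih]
    simp only [shift]
    congr 1
    push_cast
    ring

lemma shift_mp {A : Type*} [MeasurableSpace A] {μ : Measure (ℤ → A)}
    (hstat : μ.map shift = μ) : MeasurePreserving shift μ μ :=
  ⟨measurable_pi_lambda _ fun _ => measurable_pi_apply _, hstat⟩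

lemma KK_shift {A : Type*} [MeasurableSpace A] [Countable A] {μ : Measure (ℤ → A)}
    (hstat : μ.map shift = μ) (I : Set ℤ) (w : ℤ → A) (m : ℕ) (hw : ∀ z, w (z + m) = w z) :
    μ (KK {z | z - m ∈ I} w) = μ (KK I w) := by
  rw [← ((shift_mp hstat).iterate m).measure_preimage (KK_meas I w).nullMeasurableSet]
  congr 1
  ext ω
  simp only [KK, Set.mem_preimage, Set.mem_ofPred_eq, shift_iter]
  constructor
  · intro h z hz
    have := h (z + m) (by simpa using hz)
    rwa [hw] at this
  · intro h z hz
    have := h _ hz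
    rw [← hw] at this
    simpa using this

/-- Periodicity. -/
def Per {A : Type*} (w : ℤ → A) : Prop := ∃ d : ℕ, d ≠ 0 ∧ ∀ z, w (z + d) = w z

lemma per_mul {A : Type*} {w : ℤ → A} {d : ℕ} (h : ∀ z, w (z + d) = w z) (k : ℕ) (z : ℤ) :
    w (z + (k * d : ℕ)) = w z := by
  induction k with
  | zero => simp
  | succ k ih =>
    rw [← ih, ← h (z + (k * d : ℕ))]
    congr 1
    push_cast
    ring

lemma KK_lim {A : Type*} [MeasurableSpace A] [Countable A] {μ : Measure (ℤ → A)}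
    [IsProbabilityMeasure μ] (I : ℕ → Set ℤ) (w : ℤ → A) (hm : Monotone I)
    (hu : ∀ z, ∃ k, z ∈ I k) (c : ENNReal) (hc : ∀ k, μ (KK (I k) w) = c) :
    μ (KK Set.univ w) = c := by
  have : KK Set.univ w = ⋂ k, KK (I k) w := by
    ext ω
    simp only [KK, Set.mem_iInter, Set.mem_ofPred_eq]
    constructor
    · intro h k z _
      exact h z trivial
    · intro h z _
      obtain ⟨k, hk⟩ := hu z
      exact h k z hk
  rw [this, Antitone.measure_iInter]
  · simp [hc]
  · intro k l hkl ω h z hz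
    exact h z (hm hkl hz)
  · exact fun i => (KK_meas _ _).nullMeasurableSet
  · exact ⟨0, measure_ne_top _ _⟩

lemma KK_neg {A : Type*} [MeasurableSpace A] [Countable A] {μ : Measure (ℤ → A)}
    [IsProbabilityMeasure μ] (hstat : μ.map shift = μ) (w : ℤ → A) (hw : Per w) :
    μ (KK (Set.Iio 0) w) = μ (KK Set.univ w) := by
  obtain ⟨d, hd, h⟩ := hw
  symm
  apply KK_lim (fun k => {z | z - (k * d : ℕ) ∈ Set.Iio 0})
  · intro k l hkl z hz
    have : k * d ≤ l * d := Nat.mul_le_mul_right _ hkl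
    simp only [Set.mem_ofPred_eq, Set.mem_Iio] at *
    omega
  · intro z
    refine ⟨z.toNat + 1, ?_⟩
    have : (z.toNat + 1) * 1 ≤ (z.toNat + 1) * d := Nat.mul_le_mul_left _ (by omega)
    simp only [Set.mem_ofPred_eq, Set.mem_Iio] at *
    omega
  · intro k
    exact KK_shift hstat _ _ _ (per_mul h k)

lemma KK_pos {A : Type*} [MeasurableSpace A] [Countable A] {μ : Measure (ℤ → A)}
    [IsProbabilityMeasure μ] (hstat : μ.map shift = μ) (w : ℤ → A) (hw : Per w) :
    μ (KK (Set.Ici 0) w) = μ (KK Set.univ w) := by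
  obtain ⟨d, hd, h⟩ := hw
  symm
  apply KK_lim (fun k => {z | z + (k * d : ℕ) ∈ Set.Ici 0})
  · intro k l hkl z hz
    have : k * d ≤ l * d := Nat.mul_le_mul_right _ hkl
    simp only [Set.mem_ofPred_eq, Set.mem_Ici] at *
    omega
  · intro z
    refine ⟨(-z).toNat, ?_⟩
    have : ((-z).toNat) * 1 ≤ ((-z).toNat) * d := Nat.mul_le_mul_left _ (by omega)
    simp only [Set.mem_ofPred_eq, Set.mem_Ici] at *
    omega
  · intro k
    rw [← KK_shift hstat _ _ _ (per_mul h k)]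
    congr 2
    ext z
    simp

lemma per_ext_fut {A : Type*} [MeasurableSpace A] [Countable A] {μ : Measure (ℤ → A)}
    [IsProbabilityMeasure μ] (hstat : μ.map shift = μ) (v : ℤ → A)
    (h : μ (KK (Set.Ici 0) v) ≠ 0) : ∃ w, Per w ∧ ∀ z ∈ Set.Ici (0:ℤ), RR (w z) (v z) := by
  obtain ⟨x, hx, m, hm, hxm⟩ := (shift_mp hstat).exists_mem_iterate_mem
    (KK_meas _ _).nullMeasurableSet h
  have key : ∀ z : ℤ, 0 ≤ z → RR (v z) (v (z + m)) := fun z hz => by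
    have h1 := hxm z hz
    rw [shift_iter] at h1
    exact h1.trans' (hx (z + m) (by simp; omega)).symm'
  have key2 : ∀ k : ℕ, ∀ z : ℤ, 0 ≤ z → RR (v z) (v (z + (m : ℤ) * k)) := by
    intro k z hz
    induction k with
    | zero => simpa using RR.rfl' _
    | succ k ih =>
      have := key (z + (m : ℤ) * k) (by positivity)
      have e : z + (m : ℤ) * (k + 1 : ℕ) = z + (m : ℤ) * k + m := by push_cast; ring
      rw [e]
      exact ih.trans' this
  have hm' : (m : ℤ) ≠ 0 := by exact_mod_cast hm
  refine ⟨fun z => v (z % m), ⟨m, hm, fun z => by simp⟩, ?_⟩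
  intro z hz
  have := key2 (z / m).toNat (z % m) (Int.emod_nonneg _ hm')
  rwa [Int.toNat_of_nonneg (Int.ediv_nonneg hz (by positivity)), Int.emod_add_mul_ediv] at this

lemma per_ext_past {A : Type*} [MeasurableSpace A] [Countable A] {μ : Measure (ℤ → A)}
    [IsProbabilityMeasure μ] (hstat : μ.map shift = μ) (v : ℤ → A)
    (h : μ (KK (Set.Iio 0) v) ≠ 0) : ∃ w, Per w ∧ ∀ z ∈ Set.Iio (0:ℤ), RR (w z) (v z) := by
  obtain ⟨x, hx, m, hm, hxm⟩ := (shift_mp hstat).exists_mem_iterate_mem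
    (KK_meas _ _).nullMeasurableSet h
  have key : ∀ z : ℤ, z < 0 → RR (v z) (v (z - m)) := fun z hz => by
    have h1 := hxm (z - m) (by simp; omega)
    rw [shift_iter] at h1
    have h2 := hx z hz
    simp only [sub_add_cancel] at h1
    exact h2.trans' h1.symm'
  have key2 : ∀ k : ℕ, ∀ z : ℤ, z < 0 → RR (v z) (v (z - (m : ℤ) * k)) := by
    intro k z hz
    induction k with
    | zero => simpa using RR.rfl' _
    | succ k ih =>
      have h0 : 0 ≤ (m : ℤ) * k := by positivity
      have := key (z - (m : ℤ) * k) (by omega)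
      have e : z - (m : ℤ) * (k + 1 : ℕ) = z - (m : ℤ) * k - m := by push_cast; ring
      rw [e]
      exact ih.trans' this
  have hm' : 0 < (m : ℤ) := by omega
  refine ⟨fun z => v (z % m - m), ⟨m, hm, fun z => by simp⟩, ?_⟩
  intro z hz
  have h1 := Int.emod_lt_of_pos z hm'
  have h3 := Int.emod_add_mul_ediv z m
  have h4 : z / m ≤ -1 := by
    have := Int.ediv_neg_of_neg_of_pos hz hm'
    omega
  have := key2 (-1 - z / m).toNat (z % m - m) (by omega)
  rw [Int.toNat_of_nonneg (by omega)] at this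
  have e : z % m - m - m * (-1 - z / m) = z := by linarith
  rwa [e] at this

lemma KK_agree {A : Type*} [MeasurableSpace A] [Countable A] {μ : Measure (ℤ → A)}
    [IsProbabilityMeasure μ] {I : Set ℤ} {w v : ℤ → A}
    (hI : μ (KK I w) = μ (KK Set.univ w)) (hv : μ (KK Set.univ v) ≠ 0)
    (h : ∀ z ∈ I, RR (w z) (v z)) : ∀ z, RR (w z) (v z) := by
  by_contra hcon
  have hdis : Disjoint (KK Set.univ w) (KK Set.univ v) := by
    rw [Set.disjoint_left]
    intro ω h1 h2
    exact hcon fun z => (h1 z trivial).trans' (h2 z trivial).symm'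
  have hsub : KK Set.univ w ∪ KK Set.univ v ⊆ KK I w := by
    rintro ω (h1 | h1) z hz
    · exact h1 z trivial
    · exact (h z hz).trans' (h1 z trivial)
  have h1 := measure_mono (μ := μ) hsub
  rw [measure_union hdis (KK_meas _ _), hI] at h1
  have h2 : μ (KK Set.univ w) + μ (KK Set.univ v) ≤ μ (KK Set.univ w) + 0 := by simpa using h1
  rw [ENNReal.add_le_add_iff_left (measure_ne_top _ _)] at h2
  exact hv (nonpos_iff_eq_zero.1 h2)

/-- Join a past and a future. -/
def jn {A : Type*} (p f : ℕ → A) : ℤ → A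
  | Int.ofNat n => f n
  | Int.negSucc n => p n

lemma Fut_jn {A : Type*} (p f : ℕ → A) : Fut (jn p f) = f := rfl

lemma neg_form (n : ℕ) : -((n : ℤ) + 1) = Int.negSucc n := by
  rw [Int.negSucc_eq]

lemma Past_jn {A : Type*} (p f : ℕ → A) : Past (jn p f) = p := by
  funext n
  simp only [Past, neg_form, jn]

lemma jn_eta {A : Type*} (w : ℤ → A) : jn (Past w) (Fut w) = w := by
  funext z
  cases z with
  | ofNat n => rfl
  | negSucc n => simp only [jn, Past, neg_form]

lemma Fut_iff (P : ℤ → Prop) :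
    (∀ z ∈ Set.Ici (0:ℤ), P z) ↔ ∀ n : ℕ, P n := by
  constructor
  · intro h n
    exact h n (by simp)
  · intro h z hz
    obtain ⟨n, rfl⟩ := Int.eq_ofNat_of_zero_le hz
    exact h n

lemma Past_iff (P : ℤ → Prop) :
    (∀ z ∈ Set.Iio (0:ℤ), P z) ↔ ∀ n : ℕ, P (-((n : ℤ) + 1)) := by
  constructor
  · intro h n
    exact h _ (by simp; omega)
  · intro h z hz
    obtain ⟨n, rfl⟩ := Int.eq_negSucc_of_lt_zero hz
    rw [← neg_form]
    exact h n

lemma mu_Fut {A : Type*} [MeasurableSpace A] (μ : Measure (ℤ → A)) (w : ℤ → A) :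
    μ (Fut ⁻¹' {Fut w}) = μ (KK (Set.Ici 0) w) := by
  rw [← sat_eq]
  congr 1
  ext ω
  simp only [Set.mem_preimage, Set.mem_singleton_iff, Set.mem_ofPred_eq,
    Fut_iff (fun z => ω z = w z)]
  exact funext_iff

lemma mu_Past {A : Type*} [MeasurableSpace A] (μ : Measure (ℤ → A)) (w : ℤ → A) :
    μ {ω | Past ω = Past w} = μ (KK (Set.Iio 0) w) := by
  rw [← sat_eq]
  congr 1
  ext ω
  simp only [Set.mem_ofPred_eq, Past_iff (fun z => ω z = w z)]
  exact funext_iff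

lemma mu_both {A : Type*} [MeasurableSpace A] (μ : Measure (ℤ → A)) (w : ℤ → A) :
    μ {ω | Fut ω = Fut w ∧ Past ω = Past w} = μ (KK Set.univ w) := by
  rw [← sat_eq]
  congr 1
  ext ω
  simp only [Set.mem_ofPred_eq, Set.mem_univ, true_imp_iff]
  constructor
  · rintro ⟨h1, h2⟩ z
    rw [← jn_eta ω, ← jn_eta w, h1, h2]
  · intro h
    have : ω = w := funext h
    subst this
    exact ⟨rfl, rfl⟩

lemma condFut_eq {A : Type*} [MeasurableSpace A] (μ : Measure (ℤ → A)) (w : ℤ → A) :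
    condFut μ (Fut w) (Past w) = μ (KK Set.univ w) / μ (KK (Set.Iio 0) w) := by
  rw [condFut, mu_both, mu_Past]

lemma condFut_eq' {A : Type*} [MeasurableSpace A] (μ : Measure (ℤ → A)) (f p : ℕ → A) :
    condFut μ f p = μ (KK Set.univ (jn p f)) / μ (KK (Set.Iio 0) (jn p f)) := by
  rw [← condFut_eq, Fut_jn, Past_jn]

lemma eps_eq_iff {A : Type*} [MeasurableSpace A] (μ : Measure (ℤ → A)) (p p' : ℕ → A) :
    eps μ p = eps μ p' ↔ causalEquiv μ p p' := by
  constructor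
  · intro h
    have : p' ∈ eps μ p' := fun _ => rfl
    rw [← h] at this
    exact this
  · intro h
    ext q
    exact ⟨fun hq f => (h f).symm.trans (hq f), fun hq f => (h f).trans (hq f)⟩

lemma state_pre {A : Type*} [MeasurableSpace A] [Countable A] {μ : Measure (ℤ → A)}
    [IsProbabilityMeasure μ] (hstat : μ.map shift = μ) (w : ℤ → A) (hw : Per w)
    (hm : μ (KK Set.univ w) ≠ 0) :
    epsState μ ⁻¹' {eps μ (Past w)} = KK (Set.Iio 0) w := by
  ext ω
  simp only [Set.mem_preimage, Set.mem_singleton_iff, epsState, eps_eq_iff]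
  constructor
  · intro h
    have h1 := h (Fut w)
    rw [condFut_eq, KK_neg hstat w hw, ENNReal.div_self hm (measure_ne_top _ _),
      condFut_eq'] at h1
    have h2 : μ (KK Set.univ (jn (Past ω) (Fut w))) ≠ 0 := by
      intro h0
      simp [h0] at h1
    have h3 := KK_agree (KK_pos hstat w hw) h2 (by
      rw [Fut_iff (fun z => RR (w z) (jn (Past ω) (Fut w) z))]
      intro n
      exact RR.rfl' _)
    refine (Past_iff (fun z => RR (w z) (ω z))).2 fun n => ?_
    have h4 := h3 (-((n : ℤ) + 1))
    rw [neg_form] at h4 ⊢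
    simpa only [jn, Past, neg_form] using h4
  · intro h f
    rw [condFut_eq', condFut_eq']
    have key : ∀ z, RR (jn (Past ω) f z) (jn (Past w) f z) := by
      intro z
      cases z with
      | ofNat n => exact RR.rfl' _
      | negSucc n =>
        simp only [jn, Past]
        exact (h (-((n : ℤ) + 1)) (by simp; omega)).symm'
    rw [KK_congr (I := Set.univ) fun z _ => key z,
      KK_congr (I := Set.Iio 0) fun z _ => key z]

lemma exF {A : Type*} [MeasurableSpace A] [Countable A] {μ : Measure (ℤ → A)}
    [IsProbabilityMeasure μ] (hstat : μ.map shift = μ) (f : ℕ → A)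
    (hf : μ (Fut ⁻¹' {f}) ≠ 0) : ∃ w : ℤ → A, Per w ∧ (∀ n : ℕ, RR (w n) (f n)) ∧
      μ (KK Set.univ w) = μ (Fut ⁻¹' {f}) := by
  have e : f = Fut (jn f f) := rfl
  have e2 : μ (Fut ⁻¹' {f}) = μ (KK (Set.Ici 0) (jn f f)) := mu_Fut μ (jn f f)
  obtain ⟨w, hw, h⟩ := per_ext_fut hstat (jn f f) (by rwa [← e2])
  refine ⟨w, hw, (Fut_iff (fun z => RR (w z) (jn f f z))).1 h, ?_⟩
  rw [e2, ← KK_congr h, KK_pos hstat w hw]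

lemma exS {A : Type*} [MeasurableSpace A] [Countable A] {μ : Measure (ℤ → A)}
    [IsProbabilityMeasure μ] (hstat : μ.map shift = μ) (s : Set (ℕ → A))
    (hs : μ (epsState μ ⁻¹' {s}) ≠ 0) (hN : s ≠ {p | ∀ f, condFut μ f p = 0}) :
    ∃ w : ℤ → A, Per w ∧ s = eps μ (Past w) ∧ μ (KK Set.univ w) ≠ 0 := by
  obtain ⟨ω, hω⟩ : (epsState μ ⁻¹' {s}).Nonempty := nonempty_of_measure_ne_zero hs
  have hω' : eps μ (Past ω) = s := hω
  have hp : μ (KK (Set.Iio 0) ω) ≠ 0 := by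
    intro h0
    apply hN
    rw [← hω']
    have hz : ∀ f, condFut μ f (Past ω) = 0 := by
      intro f
      have : μ {ω' | Fut ω' = f ∧ Past ω' = Past ω} = 0 :=
        measure_mono_null (fun x hx => hx.2) ((mu_Past μ ω).trans h0)
      simp [condFut, this]
    ext p
    constructor
    · intro h f
      rw [← h f, hz]
    · intro h f
      rw [hz, h f]
  obtain ⟨w, hw, h⟩ := per_ext_past hstat ω hp
  have hm : μ (KK Set.univ w) ≠ 0 := by
    rwa [← KK_neg hstat w hw, KK_congr h]
  refine ⟨w, hw, ?_, hm⟩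
  have : ω ∈ epsState μ ⁻¹' {eps μ (Past w)} := by
    rw [state_pre hstat w hw hm]
    exact h
  exact hω'.symm.trans this

lemma collapse {A : Type*} [MeasurableSpace A] [Countable A] {μ : Measure (ℤ → A)}
    [IsProbabilityMeasure μ] (hstat : μ.map shift = μ)
    (hFutFin : Summable fun f : ℕ → A => Real.negMulLog (pr μ (Fut ⁻¹' {f})))
    (f f' : ℕ → A) (hf : Real.negMulLog (pr μ (Fut ⁻¹' {f})) ≠ 0)
    (h : ∀ n, RR (f n) (f' n)) : f = f' := by
  classical
  by_contra hne
  obtain ⟨i, hi⟩ := Function.ne_iff.1 hne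
  have hf0 : μ (Fut ⁻¹' {f}) ≠ 0 := by
    intro h0
    apply hf
    simp [pr, h0]
  obtain ⟨w, ⟨d, hd, hw⟩, hwf, -⟩ := exF hstat f hf0
  have hper : ∀ k : ℕ, RR (f i) (f (i + k * d)) := by
    intro k
    have h1 := hwf (i + k * d)
    have h2 := per_mul hw k i
    push_cast at h1 h2
    rw [h2] at h1
    exact (hwf i).symm'.trans' h1
  have hb : ∀ k : ℕ, ∃ b, RR (f i) b ∧ b ≠ f (i + k * d) := by
    intro k
    by_cases hk : f i = f (i + k * d)
    · exact ⟨f' i, h i, fun h2 => hi (hk.trans h2.symm)⟩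
    · exact ⟨f i, RR.rfl' _, hk⟩
  choose b hb1 hb2 using hb
  let φ : ℕ → (ℕ → A) := fun k => Function.update f (i + k * d) (b k)
  have hinj : Function.Injective φ := by
    intro k l hkl
    by_contra hne
    have h1 : φ k (i + k * d) = φ l (i + k * d) := by rw [hkl]
    have h2 : i + k * d ≠ i + l * d := by
      intro h3
      exact hne (Nat.eq_of_mul_eq_mul_right (Nat.pos_of_ne_zero hd) (by omega))
    simp only [φ, Function.update_self, Function.update_of_ne h2] at h1
    exact hb2 k h1
  have hφ : ∀ k, μ (Fut ⁻¹' {φ k}) = μ (Fut ⁻¹' {f}) := by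
    intro k
    rw [← Fut_jn f (φ k), ← Fut_jn f f, mu_Fut, mu_Fut]
    symm
    congr 1
    apply KK_congr
    rw [Fut_jn]
    rw [Fut_iff (fun z => RR (jn f f z) (jn f (φ k) z))]
    intro n
    change RR (f n) (φ k n)
    by_cases hn : n = i + k * d
    · subst hn
      simp only [φ, Function.update_self]
      exact (hper k).symm'.trans' (hb1 k)
    · simp only [φ, Function.update_of_ne hn]
      exact RR.rfl' _
  have hs := hFutFin.comp_injective hinj
  have : ((fun f : ℕ → A => Real.negMulLog (pr μ (Fut ⁻¹' {f}))) ∘ φ) =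
      fun _ => Real.negMulLog (pr μ (Fut ⁻¹' {f})) := by
    funext k
    simp only [Function.comp, pr, hφ]
  rw [this, summable_const_iff] at hs
  exact hf hs

lemma pr_nonneg' {Ω : Type*} [MeasurableSpace Ω] (μ : Measure Ω) (E : Set Ω) : 0 ≤ pr μ E :=
  ENNReal.toReal_nonneg

lemma nml_nonneg {Ω : Type*} [MeasurableSpace Ω] (μ : Measure Ω) [IsProbabilityMeasure μ]
    (E : Set Ω) : 0 ≤ Real.negMulLog (pr μ E) :=
  Real.negMulLog_nonneg (pr_nonneg' μ E) (by
    have := ENNReal.toReal_mono ENNReal.one_ne_top (prob_le_one (μ := μ) (s := E))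
    simpa [pr] using this)

lemma cent_nonneg {Ω α β : Type*} [MeasurableSpace Ω] (μ : Measure Ω) [IsProbabilityMeasure μ]
    (X : Ω → α) (Y : Ω → β) : 0 ≤ cent μ X Y := by
  apply tsum_nonneg
  intro q
  rcases (pr_nonneg' μ (X ⁻¹' {q.1} ∩ Y ⁻¹' {q.2})).eq_or_lt with h | h
  · simp [← h]
  · apply mul_nonneg h.le
    apply Real.log_nonneg
    rw [one_le_div h]
    exact ENNReal.toReal_mono (measure_ne_top _ _) (measure_mono Set.inter_subset_right)

lemma ent_le {A : Type*} [MeasurableSpace A] [Countable A] {μ : Measure (ℤ → A)}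
    [IsProbabilityMeasure μ] (hstat : μ.map shift = μ)
    (hFutFin : Summable fun f : ℕ → A => Real.negMulLog (pr μ (Fut ⁻¹' {f}))) :
    ent μ Fut ≤ ent μ (epsState μ) := by
  classical
  have ne0 : ∀ E : Set (ℤ → A), Real.negMulLog (pr μ E) ≠ 0 → μ E ≠ 0 := by
    intro E h h0
    apply h
    simp [pr, h0]
  -- summability of the state entropy
  have hS : Summable fun s => Real.negMulLog (pr μ (epsState μ ⁻¹' {s})) := by
    set S : Set (ℕ → A) → ℝ := fun s => Real.negMulLog (pr μ (epsState μ ⁻¹' {s})) with hSdef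
    set N : Set (ℕ → A) := {p | ∀ f, condFut μ f p = 0} with hN
    let T : Set (Set (ℕ → A)) := {s | S s ≠ 0 ∧ s ≠ N}
    have hex : ∀ s : T, ∃ w : ℤ → A, Per w ∧ s.1 = eps μ (Past w) ∧ μ (KK Set.univ w) ≠ 0 :=
      fun s => exS hstat s.1 (ne0 _ s.2.1) s.2.2
    choose w hw1 hw2 hw3 using hex
    have hinj : Function.Injective fun s : T => Fut (w s) := by
      intro s t hst
      have h1 := KK_agree (KK_pos hstat _ (hw1 s)) (hw3 t) (by
        rw [Fut_iff (fun z => RR (w s z) (w t z))]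
        intro n
        have : w s n = w t n := congrFun hst n
        rw [this]
        exact RR.rfl' _)
      have h2 : w t ∈ epsState μ ⁻¹' {eps μ (Past (w s))} := by
        rw [state_pre hstat _ (hw1 s) (hw3 s)]
        exact fun z _ => h1 z
      have h3 : eps μ (Past (w t)) = eps μ (Past (w s)) := h2
      apply Subtype.ext
      rw [hw2 s, hw2 t, h3]
    have h1 : Summable (S ∘ (Subtype.val : T → Set (ℕ → A))) := by
      have := hFutFin.comp_injective hinj
      refine this.congr fun s => ?_
      simp only [Function.comp, hSdef, pr]
      rw [mu_Fut, KK_pos hstat _ (hw1 s), hw2 s, state_pre hstat _ (hw1 s) (hw3 s),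
        KK_neg hstat _ (hw1 s)]
    rw [summable_subtype_iff_indicator] at h1
    have h2 : Summable (Set.indicator {N} S) :=
      summable_of_hasFiniteSupport ((Set.finite_singleton N).subset Set.support_indicator_subset)
    refine Summable.of_nonneg_of_le (fun s => nml_nonneg μ _) (fun s => ?_) (h1.add h2)
    by_cases hsN : s = N
    · have : s ∉ T := fun h => h.2 hsN
      simp [Set.indicator, this, hsN, hSdef, T]
    · by_cases hs0 : S s = 0
      · have : s ∉ T := fun h => h.1 hs0
        have h5 : S s ≤ 0 := hs0.le
        simpa [Set.indicator, this, hsN] using h5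
      · have : s ∈ T := ⟨hs0, hsN⟩
        simp [Set.indicator, this, hsN, hSdef]
  unfold ent
  rw [← tsum_subtype_support (fun f : ℕ → A => Real.negMulLog (pr μ (Fut ⁻¹' {f})))]
  have hex := fun f : Function.support
    (fun f : ℕ → A => Real.negMulLog (pr μ (Fut ⁻¹' {f}))) => exF hstat f.1 (ne0 _ f.2)
  choose w hw1 hw2 hw3 using hex
  have hm : ∀ f, μ (KK Set.univ (w f)) ≠ 0 := fun f => by
    rw [hw3]
    exact ne0 _ f.2
  refine Summable.tsum_le_tsum_of_inj (fun f => eps μ (Past (w f))) ?_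
    (fun s _ => nml_nonneg μ _) (fun f => ?_) (hFutFin.comp_injective Subtype.val_injective) hS
  · intro f g hfg
    have h2 : w g ∈ epsState μ ⁻¹' {eps μ (Past (w f))} := hfg.symm
    rw [state_pre hstat _ (hw1 f) (hm f)] at h2
    have h1 := KK_agree (KK_neg hstat _ (hw1 f)) (hm g) h2
    apply Subtype.ext
    exact collapse hstat hFutFin f.1 g.1 f.2 fun n =>
      (hw2 f n).symm'.trans' ((h1 n).trans' (hw2 g n))
  · apply le_of_eq
    simp only [pr]
    rw [state_pre hstat _ (hw1 f) (hm f), KK_neg hstat _ (hw1 f), hw3]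

end Helpers

/-- Finite-Control Theorem: when the semi-infinite future has finite entropy,
`H[Future] − H[Future | R̂] ≤ C_μ` for every prescient rival `R̂`. -/
theorem finite_control_theorem {A R : Type*} [Countable A] [Countable R]
    [MeasurableSpace A]
    (μ : Measure (ℤ → A)) [IsProbabilityMeasure μ]
    (hstat : μ.map shift = μ)
    (η : (ℕ → A) → R)
    (hFutFin : Summable fun f : ℕ → A => Real.negMulLog (pr μ (Fut ⁻¹' {f})))
    (hprescient : cent μ Fut (fun ω => η (Past ω)) = cent μ Fut (epsState μ)) :
    ent μ Fut - cent μ Fut (fun ω => η (Past ω)) ≤ ent μ (epsState μ) := by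
  have h1 := cent_nonneg μ Fut (fun ω => η (Past ω))
  have h2 := ent_le hstat hFutFin
  linarith
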